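/- There exist positive constants c₁, c₂ such that for every n ≥ 1, every Boolean function f : {−1,1}^n → {0,1}, and every η ∈ (0,1), VAR(f,η) ≤ c₁ · (Σ_{i=1}^n I_i(f)²)^{c₂ η}. -/

import Mathlib

open Finset

/-- Expectation with respect to the uniform measure `ν` on the discrete cube `{-1,1}ⁿ`,
coordinates encoded by `Bool` (`true ↔ 1`, `false ↔ -1`). -/
noncomputable def cubeE (n : ℕ) (f : (Fin n → Bool) → ℝ) : ℝ :=
  (∑ x : Fin n → Bool, f x) / 2 ^ n

/-- Variance with respect to the uniform measure on the discrete cube. -/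
noncomputable def cubeVar (n : ℕ) (f : (Fin n → Bool) → ℝ) : ℝ :=
  cubeE n (fun x => f x ^ 2) - (cubeE n f) ^ 2

/-- `τ_i x` : flip the `i`-th coordinate. -/
def cubeFlip (n : ℕ) (i : Fin n) (x : Fin n → Bool) : Fin n → Bool :=
  Function.update x i (!(x i))

/-- Discrete derivative `D_i f (x) = f (τ_i x) - f x`. -/
noncomputable def Dop (n : ℕ) (i : Fin n) (f : (Fin n → Bool) → ℝ) (x : Fin n → Bool) : ℝ :=
  f (cubeFlip n i x) - f x

/-- Joint probability weight for one coordinate of the pair `(X, X^η)`, where `X` is uniform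
on `{-1,1}` and `X^η` equals `X` with probability `1-η` and is an independent uniform sign
with probability `η` : `P(X = a, X^η = b)` equals `(2-η)/4` if `a = b` and `η/4` otherwise. -/
noncomputable def nsW (η : ℝ) (a b : Bool) : ℝ := if a = b then (2 - η) / 4 else η / 4

/-- Noise stability `VAR(f,η) = E[f(X) f(X^η)] - (E f)²`, where `(X, X^η)` is the pair of
`(1-η)`-correlated uniform random points of the cube, with explicit joint distribution
`P(X = x, X^η = y) = ∏ᵢ nsW η xᵢ yᵢ`. -/
noncomputable def cubeNS (n : ℕ) (f : (Fin n → Bool) → ℝ) (η : ℝ) : ℝ :=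
  (∑ x : Fin n → Bool, ∑ y : Fin n → Bool, f x * f y * ∏ i, nsW η (x i) (y i)) -
    (cubeE n f) ^ 2

/-- The sign `±1` encoded by a Boolean. -/
noncomputable def boolSign (b : Bool) : ℝ := if b then 1 else -1

/-- The Walsh function `χ_S(x) = ∏_{i ∈ S} x_i`. -/
noncomputable def walsh {n : ℕ} (S : Finset (Fin n)) (x : Fin n → Bool) : ℝ :=
  ∏ i ∈ S, boolSign (x i)

/-- The Fourier–Walsh coefficient of `f` at `S`. -/
noncomputable def walshCoeff {n : ℕ} (f : (Fin n → Bool) → ℝ) (S : Finset (Fin n)) : ℝ :=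
  cubeE n fun x => f x * walsh S x

/-- The transition kernel of the noise operator with correlation `ρ`. -/
noncomputable def noiseKernel {n : ℕ} (ρ : ℝ) (x y : Fin n → Bool) : ℝ :=
  ∏ i, (1 + ρ * (boolSign (x i) * boolSign (y i))) / 2

/-- The noise operator with correlation `ρ`. -/
noncomputable def noiseOp {n : ℕ} (ρ : ℝ) (f : (Fin n → Bool) → ℝ) (x : Fin n → Bool) : ℝ :=
  ∑ y, noiseKernel ρ x y * f y

section Expectation

variable {n : ℕ}

lemma cubeE_mono {f g : (Fin n → Bool) → ℝ} (h : ∀ x, f x ≤ g x) : cubeE n f ≤ cubeE n g := by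
  unfold cubeE
  gcongr with x
  exact h x

lemma cubeE_nonneg {f : (Fin n → Bool) → ℝ} (h : ∀ x, 0 ≤ f x) : 0 ≤ cubeE n f :=
  div_nonneg (sum_nonneg fun x _ => h x) (by positivity)

lemma cubeE_add (f g : (Fin n → Bool) → ℝ) :
    cubeE n (fun x => f x + g x) = cubeE n f + cubeE n g := by
  simp only [cubeE, sum_add_distrib, add_div]

lemma cubeE_const_mul (c : ℝ) (f : (Fin n → Bool) → ℝ) :
    cubeE n (fun x => c * f x) = c * cubeE n f := by
  simp only [cubeE, ← mul_sum, mul_div_assoc]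

lemma cubeE_mul_sq_le (f g : (Fin n → Bool) → ℝ) :
    cubeE n (fun x => f x * g x) ^ 2 ≤
      cubeE n (fun x => f x ^ 2) * cubeE n (fun x => g x ^ 2) := by
  simp only [cubeE]
  rw [div_pow, div_mul_div_comm, ← sq]
  gcongr
  exact sum_mul_sq_le_sq_mul_sq _ _ _

lemma sum_boolCube_succ (f : (Fin (n + 1) → Bool) → ℝ) :
    ∑ x, f x = ∑ x, f (Fin.cons true x) + ∑ x, f (Fin.cons false x) := by
  rw [← (Fin.consEquiv fun _ => Bool).sum_comp, Fintype.sum_prod_type, Fintype.sum_bool]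
  rfl

lemma cubeE_succ (f : (Fin (n + 1) → Bool) → ℝ) :
    cubeE (n + 1) f =
      (cubeE n (fun x => f (Fin.cons true x)) + cubeE n (fun x => f (Fin.cons false x))) / 2 := by
  simp only [cubeE, sum_boolCube_succ]
  ring

end Expectation

section Noise

variable {n : ℕ}

lemma boolSign_mul_self (b : Bool) : boolSign b * boolSign b = 1 := by
  cases b <;> simp [boolSign]

lemma noiseKernel_comm (ρ : ℝ) (x y : Fin n → Bool) : noiseKernel ρ x y = noiseKernel ρ y x := by
  simp only [noiseKernel, mul_comm (boolSign (x _))]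

lemma noiseKernel_nonneg {ρ : ℝ} (h₀ : 0 ≤ ρ) (h₁ : ρ ≤ 1) (x y : Fin n → Bool) :
    0 ≤ noiseKernel ρ x y := by
  refine prod_nonneg fun i _ => ?_
  cases x i <;> cases y i <;> simp [boolSign] <;> linarith

lemma sum_noiseKernel_mul_walsh (ρ : ℝ) (S : Finset (Fin n)) (x : Fin n → Bool) :
    ∑ y, noiseKernel ρ x y * walsh S y = ρ ^ #S * walsh S x := by
  have h (y : Fin n → Bool) : noiseKernel ρ x y * walsh S y =
      ∏ i, ((1 + ρ * (boolSign (x i) * boolSign (y i))) / 2 *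
        if i ∈ S then boolSign (y i) else 1) := by
    simp only [noiseKernel, walsh, prod_mul_distrib, prod_ite_mem, univ_inter]
  have h' : ρ ^ #S * walsh S x = ∏ i, if i ∈ S then ρ * boolSign (x i) else 1 := by
    simp [walsh, prod_mul_distrib]
  simp_rw [h, h']
  rw [← Fintype.prod_sum fun i b => (1 + ρ * (boolSign (x i) * boolSign b)) / 2 *
        if i ∈ S then boolSign b else 1]
  refine prod_congr rfl fun i _ => ?_
  split_ifs <;> simp [boolSign] <;> ring

lemma noiseKernel_eq_sum (ρ : ℝ) (x y : Fin n → Bool) :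
    noiseKernel ρ x y = (∑ S, ρ ^ #S * (walsh S x * walsh S y)) / 2 ^ n := by
  simp only [noiseKernel, prod_div_distrib, prod_const, card_univ, Fintype.card_fin,
    prod_one_add, powerset_univ, walsh, prod_mul_distrib]

lemma noiseKernel_one (x y : Fin n → Bool) : noiseKernel 1 x y = if y = x then 1 else 0 := by
  split_ifs with h
  · subst h
    simp [noiseKernel, boolSign_mul_self]
  · obtain ⟨i, hi⟩ := Function.ne_iff.mp h
    refine prod_eq_zero (mem_univ i) ?_
    revert hi
    cases x i <;> cases y i <;> simp [boolSign]

lemma noiseOp_one (f : (Fin n → Bool) → ℝ) : noiseOp 1 f = f := by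
  ext x
  simp [noiseOp, noiseKernel_one]

lemma cubeE_mul_noiseOp (ρ : ℝ) (f : (Fin n → Bool) → ℝ) :
    cubeE n (fun x => f x * noiseOp ρ f x) = ∑ S, ρ ^ #S * walshCoeff f S ^ 2 := by
  have h (S : Finset (Fin n)) : ρ ^ #S * walshCoeff f S ^ 2 =
      (∑ x, ∑ y, f x * (ρ ^ #S * (walsh S x * walsh S y) / 2 ^ n * f y)) / 2 ^ n := by
    simp only [walshCoeff, cubeE, sq, div_mul_div_comm, sum_mul_sum]
    rw [mul_div_assoc', mul_sum, ← div_div]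
    congr 1
    rw [sum_div]
    refine sum_congr rfl fun x _ => ?_
    rw [mul_sum, sum_div]
    refine sum_congr rfl fun y _ => ?_
    ring
  simp_rw [h, ← sum_div, cubeE]
  congr 1
  rw [sum_comm]
  refine sum_congr rfl fun x _ => ?_
  rw [sum_comm, noiseOp, mul_sum]
  refine sum_congr rfl fun y _ => ?_
  rw [noiseKernel_eq_sum, sum_div, sum_mul, mul_sum]

lemma sum_walshCoeff_sq (f : (Fin n → Bool) → ℝ) :
    ∑ S, walshCoeff f S ^ 2 = cubeE n (fun x => f x ^ 2) := by
  simpa [noiseOp_one, sq] using (cubeE_mul_noiseOp 1 f).symm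

lemma walshCoeff_noiseOp (ρ : ℝ) (f : (Fin n → Bool) → ℝ) (S : Finset (Fin n)) :
    walshCoeff (noiseOp ρ f) S = ρ ^ #S * walshCoeff f S := by
  simp only [walshCoeff, cubeE]
  rw [mul_div_assoc']
  congr 1
  simp_rw [noiseOp, sum_mul, mul_sum]
  rw [sum_comm]
  refine sum_congr rfl fun y _ => ?_
  have h := sum_noiseKernel_mul_walsh ρ S y
  calc ∑ x, noiseKernel ρ x y * f y * walsh S x
      = f y * ∑ x, noiseKernel ρ y x * walsh S x := by
        rw [mul_sum]
        exact sum_congr rfl fun x _ => by rw [noiseKernel_comm]; ring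
    _ = ρ ^ #S * (f y * walsh S y) := by rw [h]; ring

lemma cubeE_noiseOp_sq (ρ : ℝ) (f : (Fin n → Bool) → ℝ) :
    cubeE n (fun x => noiseOp ρ f x ^ 2) = ∑ S, (ρ ^ 2) ^ #S * walshCoeff f S ^ 2 := by
  rw [← sum_walshCoeff_sq]
  refine sum_congr rfl fun S _ => ?_
  rw [walshCoeff_noiseOp]
  ring

lemma cubeE_noiseOp_mul (ρ : ℝ) (f g : (Fin n → Bool) → ℝ) :
    cubeE n (fun x => noiseOp ρ f x * g x) = cubeE n (fun x => f x * noiseOp ρ g x) := by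
  simp only [cubeE]
  congr 1
  simp_rw [noiseOp, sum_mul, mul_sum]
  rw [sum_comm]
  refine sum_congr rfl fun y _ => sum_congr rfl fun x _ => ?_
  rw [noiseKernel_comm]
  ring

lemma cubeE_noiseOp (ρ : ℝ) (f : (Fin n → Bool) → ℝ) : cubeE n (noiseOp ρ f) = cubeE n f := by
  simpa [walshCoeff, walsh] using walshCoeff_noiseOp ρ f ∅

lemma cubeE_abs_noiseOp_le {ρ : ℝ} (h₀ : 0 ≤ ρ) (h₁ : ρ ≤ 1) (f : (Fin n → Bool) → ℝ) :
    cubeE n (fun x => |noiseOp ρ f x|) ≤ cubeE n (fun x => |f x|) := by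
  rw [← cubeE_noiseOp ρ fun x => |f x|]
  refine cubeE_mono fun x => (abs_sum_le_sum_abs _ _).trans_eq ?_
  refine sum_congr rfl fun y _ => ?_
  rw [abs_mul, abs_of_nonneg (noiseKernel_nonneg h₀ h₁ x y)]

lemma noiseOp_linear (ρ a b : ℝ) (f g : (Fin n → Bool) → ℝ) (x : Fin n → Bool) :
    noiseOp ρ (fun y => a * f y + b * g y) x = a * noiseOp ρ f x + b * noiseOp ρ g x := by
  simp only [noiseOp, mul_sum, ← sum_add_distrib]
  exact sum_congr rfl fun y _ => by ring

lemma noiseOp_cons (ρ : ℝ) (f : (Fin (n + 1) → Bool) → ℝ) (a : Bool) (x : Fin n → Bool) :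
    noiseOp ρ f (Fin.cons a x) =
      (1 + ρ * boolSign a) / 2 * noiseOp ρ (fun y => f (Fin.cons true y)) x +
        (1 - ρ * boolSign a) / 2 * noiseOp ρ (fun y => f (Fin.cons false y)) x := by
  simp only [noiseOp]
  rw [sum_boolCube_succ, mul_sum, mul_sum]
  congr 1 <;> refine sum_congr rfl fun y _ => ?_ <;>
    simp [noiseKernel, Fin.prod_univ_succ, boolSign] <;> ring

/-- Bonami's `(2,4)`-hypercontractive inequality, with correlation `1/2`. -/
theorem cubeE_noiseOp_pow_four_le (n : ℕ) (f : (Fin n → Bool) → ℝ) :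
    cubeE n (fun x => noiseOp (1 / 2) f x ^ 4) ≤ cubeE n (fun x => f x ^ 2) ^ 2 := by
  induction n with
  | zero =>
    simp only [cubeE, noiseOp, noiseKernel, Fintype.sum_unique]
    simp [← pow_mul]
  | succ n ih =>
    set a : (Fin n → Bool) → ℝ :=
      fun x => 1 / 2 * f (Fin.cons true x) + 1 / 2 * f (Fin.cons false x) with ha
    set b : (Fin n → Bool) → ℝ :=
      fun x => 1 / 2 * f (Fin.cons true x) + (-1 / 2) * f (Fin.cons false x) with hb
    have hL : cubeE (n + 1) (fun x => noiseOp (1 / 2) f x ^ 4) =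
        cubeE n (fun x => noiseOp (1 / 2) a x ^ 4) +
          (3 / 2 * cubeE n (fun x => noiseOp (1 / 2) a x ^ 2 * noiseOp (1 / 2) b x ^ 2) +
            1 / 16 * cubeE n (fun x => noiseOp (1 / 2) b x ^ 4)) := by
      rw [cubeE_succ, ← cubeE_add, ← cubeE_const_mul, ← cubeE_const_mul, ← cubeE_add,
        ← cubeE_add, div_eq_inv_mul, ← cubeE_const_mul]
      congr 1
      ext x
      rw [noiseOp_cons, noiseOp_cons, ha, hb, noiseOp_linear, noiseOp_linear]
      simp only [boolSign, if_true, Bool.false_eq_true, if_false]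
      ring
    have hR : cubeE (n + 1) (fun x => f x ^ 2) =
        cubeE n (fun x => a x ^ 2) + cubeE n (fun x => b x ^ 2) := by
      rw [cubeE_succ, ← cubeE_add, ← cubeE_add, div_eq_inv_mul, ← cubeE_const_mul]
      congr 1
      ext x
      simp only [ha, hb]
      ring
    have hA : 0 ≤ cubeE n (fun x => a x ^ 2) := cubeE_nonneg fun x => sq_nonneg _
    have hB : 0 ≤ cubeE n (fun x => b x ^ 2) := cubeE_nonneg fun x => sq_nonneg _
    have hab : cubeE n (fun x => noiseOp (1 / 2) a x ^ 2 * noiseOp (1 / 2) b x ^ 2) ≤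
        cubeE n (fun x => a x ^ 2) * cubeE n (fun x => b x ^ 2) := by
      refine abs_le_of_sq_le_sq' ?_ (mul_nonneg hA hB) |>.2
      refine (cubeE_mul_sq_le _ _).trans ?_
      simp only [← pow_mul, Nat.reduceMul]
      rw [mul_pow]
      exact mul_le_mul (ih a) (ih b) (cubeE_nonneg fun x => by positivity) (by positivity)
    rw [hL, hR]
    nlinarith [ih a, ih b, mul_nonneg hA hB, sq_nonneg (cubeE n fun x => b x ^ 2)]

/-- The dual hypercontractive inequality, interpolated between `L¹` and `L²`. -/
theorem cubeE_noiseOp_sq_le (f : (Fin n → Bool) → ℝ) :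
    cubeE n (fun x => noiseOp (1 / 2) f x ^ 2) ≤
      cubeE n (fun x => |f x|) * √(cubeE n (fun x => f x ^ 2)) := by
  set g := noiseOp (1 / 2) f with hg
  set X := cubeE n (fun x => g x ^ 2) with hX
  set A := cubeE n (fun x => |f x|) with hA
  set B := cubeE n (fun x => f x ^ 2) with hB
  set M := cubeE n (fun x => |f x| * noiseOp (1 / 2) g x ^ 2) with hM
  have hX₀ : 0 ≤ X := cubeE_nonneg fun x => sq_nonneg _
  have hA₀ : 0 ≤ A := cubeE_nonneg fun x => abs_nonneg _
  have hB₀ : 0 ≤ B := cubeE_nonneg fun x => sq_nonneg _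
  have hM₀ : 0 ≤ M := cubeE_nonneg fun x => by positivity
  have h₁ : X ^ 2 ≤ A * M := by
    have h : X ≤ cubeE n (fun x => √|f x| * (√|f x| * |noiseOp (1 / 2) g x|)) := by
      rw [hX]
      simp only [sq]
      nth_rw 1 [hg]
      rw [cubeE_noiseOp_mul]
      refine cubeE_mono fun x => (le_abs_self _).trans_eq ?_
      rw [abs_mul, ← mul_assoc, Real.mul_self_sqrt (abs_nonneg _)]
    refine (pow_le_pow_left₀ hX₀ h 2).trans ((cubeE_mul_sq_le _ _).trans_eq ?_)
    simp only [mul_pow, Real.sq_sqrt (abs_nonneg _), sq_abs, hA, hM]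
  have h₂ : M ^ 2 ≤ B * X ^ 2 := by
    refine (cubeE_mul_sq_le _ _).trans ?_
    simp only [sq_abs, ← pow_mul, Nat.reduceMul]
    exact mul_le_mul_of_nonneg_left (cubeE_noiseOp_pow_four_le n g) hB₀
  have h₃ : M ≤ √B * X := by
    refine (abs_le_of_sq_le_sq' ?_ (by positivity)).2
    rwa [mul_pow, Real.sq_sqrt hB₀]
  rcases hX₀.eq_or_lt with h | h
  · rw [← h]; positivity
  · have h₄ := mul_le_mul_of_nonneg_left h₃ hA₀
    refine le_of_mul_le_mul_right ?_ h
    nlinarith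

end Noise

section Influence

variable {n : ℕ}

lemma cubeFlip_involutive (i : Fin n) : Function.Involutive (cubeFlip n i) := by
  intro x
  simp [cubeFlip]

lemma walsh_cubeFlip (i : Fin n) (S : Finset (Fin n)) (x : Fin n → Bool) :
    walsh S (cubeFlip n i x) = (if i ∈ S then -1 else 1) * walsh S x := by
  have h (j : Fin n) : boolSign (cubeFlip n i x j) =
      (if j = i then -1 else 1) * boolSign (x j) := by
    by_cases hj : j = i
    · subst hj
      cases hx : x j <;> simp [cubeFlip, boolSign, hx]
    · simp [cubeFlip, hj]
  simp only [walsh, h, prod_mul_distrib, prod_ite_eq']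

lemma walshCoeff_Dop (i : Fin n) (f : (Fin n → Bool) → ℝ) (S : Finset (Fin n)) :
    walshCoeff (Dop n i f) S = if i ∈ S then -2 * walshCoeff f S else 0 := by
  have h : ∑ x, f (cubeFlip n i x) * walsh S x =
      (if i ∈ S then -1 else 1) * ∑ x, f x * walsh S x := by
    rw [← Equiv.sum_comp (cubeFlip_involutive i).toPerm, mul_sum]
    refine sum_congr rfl fun x _ => ?_
    simp only [Function.Involutive.coe_toPerm, cubeFlip_involutive i x, walsh_cubeFlip]
    ring
  simp only [walshCoeff, cubeE, Dop, sub_mul, sum_sub_distrib, h]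
  split_ifs <;> ring

lemma sum_cubeE_noiseOp_Dop_sq (ρ : ℝ) (f : (Fin n → Bool) → ℝ) :
    ∑ i, cubeE n (fun x => noiseOp ρ (Dop n i f) x ^ 2) =
      ∑ S, 4 * #S * (ρ ^ 2) ^ #S * walshCoeff f S ^ 2 := by
  simp only [cubeE_noiseOp_sq, walshCoeff_Dop]
  rw [sum_comm]
  refine sum_congr rfl fun S _ => ?_
  simp only [ite_pow, mul_ite, sum_ite_mem, univ_inter, sum_const, nsmul_eq_mul,
    zero_pow two_ne_zero, mul_zero]
  ring

lemma cubeE_noiseOp_noiseOp_sq (ρ σ : ℝ) (f : (Fin n → Bool) → ℝ) :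
    cubeE n (fun x => noiseOp ρ (noiseOp σ f) x ^ 2) =
      cubeE n (fun x => noiseOp (ρ * σ) f x ^ 2) := by
  simp only [cubeE_noiseOp_sq, walshCoeff_noiseOp]
  exact sum_congr rfl fun S _ => by ring

/-- At a fixed noise level, the nonconstant Fourier weight is controlled by the influences. -/
theorem sum_inv_sixteen_pow_mul_walshCoeff_sq_le (f : (Fin n → Bool) → ℝ)
    (hf : cubeE n (fun x => f x ^ 2) ≤ 1) :
    ∑ S ∈ univ.erase (∅ : Finset (Fin n)), walshCoeff f S ^ 2 * (1 / 16 : ℝ) ^ #S ≤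
      √(∑ i, (cubeE n fun x => |Dop n i f x|) ^ 2) := by
  set g : Fin n → (Fin n → Bool) → ℝ := fun i => noiseOp (1 / 2) (Dop n i f) with hg
  have hg₂ : ∑ i, cubeE n (fun x => g i x ^ 2) ≤ 1 := by
    rw [sum_cubeE_noiseOp_Dop_sq]
    refine (sum_le_sum fun S _ => ?_).trans ((sum_walshCoeff_sq f).trans_le hf)
    refine mul_le_of_le_one_left (sq_nonneg _) ?_
    generalize #S = k
    induction k with
    | zero => simp
    | succ k ih =>
      rcases k.eq_zero_or_pos with rfl | hk
      · norm_num
      · have hk' : (1 : ℝ) ≤ k := by exact_mod_cast hk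
        have hp : (0 : ℝ) < ((1 / 2 : ℝ) ^ 2) ^ k := by positivity
        push_cast
        rw [pow_succ]
        nlinarith
  calc ∑ S ∈ univ.erase (∅ : Finset (Fin n)), walshCoeff f S ^ 2 * (1 / 16 : ℝ) ^ #S
      ≤ ∑ S ∈ univ.erase (∅ : Finset (Fin n)),
          4 * #S * ((1 / 2 * (1 / 2) : ℝ) ^ 2) ^ #S * walshCoeff f S ^ 2 := by
        refine sum_le_sum fun S hS => ?_
        have hS : (1 : ℝ) ≤ #S := by
          exact_mod_cast card_pos.mpr (nonempty_iff_ne_empty.mpr (ne_of_mem_erase hS))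
        have hp : 0 ≤ walshCoeff f S ^ 2 * (1 / 16 : ℝ) ^ #S := by positivity
        norm_num only
        nlinarith
    _ ≤ ∑ S, 4 * #S * ((1 / 2 * (1 / 2) : ℝ) ^ 2) ^ #S * walshCoeff f S ^ 2 :=
        sum_le_sum_of_subset_of_nonneg (erase_subset _ _) fun S _ _ => by positivity
    _ = ∑ i, cubeE n (fun x => noiseOp (1 / 2) (g i) x ^ 2) := by
        rw [← sum_cubeE_noiseOp_Dop_sq]
        simp only [hg, cubeE_noiseOp_noiseOp_sq]
    _ ≤ ∑ i, cubeE n (fun x => |Dop n i f x|) * √(cubeE n (fun x => g i x ^ 2)) := by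
        refine sum_le_sum fun i _ => (cubeE_noiseOp_sq_le (g i)).trans ?_
        gcongr
        exact cubeE_abs_noiseOp_le (by norm_num) (by norm_num) _
    _ ≤ √(∑ i, (cubeE n fun x => |Dop n i f x|) ^ 2) *
          √(∑ i, √(cubeE n (fun x => g i x ^ 2)) ^ 2) := Real.sum_mul_le_sqrt_mul_sqrt _ _ _
    _ ≤ √(∑ i, (cubeE n fun x => |Dop n i f x|) ^ 2) := by
        refine mul_le_of_le_one_right (Real.sqrt_nonneg _) ?_
        simp only [Real.sq_sqrt (cubeE_nonneg fun x => sq_nonneg (g _ x))]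
        exact Real.sqrt_le_one.mpr hg₂

end Influence

lemma nsW_eq (η : ℝ) (a b : Bool) :
    nsW η a b = (1 + (1 - η) * (boolSign a * boolSign b)) / 2 / 2 := by
  cases a <;> cases b <;> simp [nsW, boolSign] <;> ring

lemma cubeNS_eq_sum (n : ℕ) (f : (Fin n → Bool) → ℝ) (η : ℝ) :
    cubeNS n f η =
      ∑ S ∈ univ.erase (∅ : Finset (Fin n)), walshCoeff f S ^ 2 * (1 - η) ^ #S := by
  have h : ∑ x, ∑ y, f x * f y * ∏ i, nsW η (x i) (y i) =
      cubeE n (fun x => f x * noiseOp (1 - η) f x) := by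
    rw [cubeE, sum_div]
    refine sum_congr rfl fun x _ => ?_
    rw [noiseOp, mul_sum, sum_div]
    refine sum_congr rfl fun y _ => ?_
    simp only [nsW_eq]
    rw [prod_div_distrib, prod_const, card_univ, Fintype.card_fin, noiseKernel]
    ring
  rw [cubeNS, h, cubeE_mul_noiseOp, ← add_sum_erase _ _ (mem_univ ∅)]
  simp [walshCoeff, walsh, mul_comm]

lemma one_sub_le_inv_sixteen_rpow {η : ℝ} (hη : 0 ≤ η) : 1 - η ≤ (1 / 16 : ℝ) ^ (η / 3) := by
  have hlog : Real.log 16 ≤ 3 := by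
    rw [Real.log_le_iff_le_exp (by norm_num)]
    have h := Real.exp_one_gt_d9
    calc (16 : ℝ) ≤ 2.7 ^ 3 := by norm_num
      _ ≤ Real.exp 1 ^ 3 := by gcongr; linarith
      _ = Real.exp 3 := by rw [← Real.exp_nat_mul]; norm_num
  rw [Real.rpow_def_of_pos (by norm_num), one_div, Real.log_inv]
  refine (Real.one_sub_le_exp_neg η).trans (Real.exp_le_exp.mpr ?_)
  nlinarith

/-- quantitative BKS theorem of Keller--Kindler: there exist positive
constants `c₁, c₂` such that for every `n ≥ 1`, every Boolean function
`f : {-1,1}ⁿ → {0,1}` and every `η ∈ (0,1)`,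
`VAR(f,η) ≤ c₁ (∑ᵢ Iᵢ(f)²)^{c₂ η}`, where `Iᵢ(f) = ‖f - f ∘ τᵢ‖₁`. -/
theorem stmt16 :
    ∃ c₁ c₂ : ℝ, 0 < c₁ ∧ 0 < c₂ ∧
      ∀ (n : ℕ), 1 ≤ n → ∀ f : (Fin n → Bool) → ℝ, (∀ x, f x = 0 ∨ f x = 1) →
        ∀ η ∈ Set.Ioo (0 : ℝ) 1,
          cubeNS n f η ≤
            c₁ * (∑ i : Fin n, (cubeE n fun x => |Dop n i f x|) ^ 2) ^ (c₂ * η) := by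
  refine ⟨1, 1 / 6, one_pos, by norm_num, fun n _ f hf η ⟨hη₀, hη₁⟩ => ?_⟩
  rw [one_mul, cubeNS_eq_sum]
  have hf₂ : cubeE n (fun x => f x ^ 2) ≤ 1 := by
    rw [cubeE, div_le_one (by positivity)]
    calc ∑ x, f x ^ 2 ≤ ∑ _x : Fin n → Bool, (1 : ℝ) :=
          sum_le_sum fun x _ => by rcases hf x with h | h <;> simp [h]
      _ = 2 ^ n := by simp
  set s := univ.erase (∅ : Finset (Fin n))
  have hs : ∑ S ∈ s, walshCoeff f S ^ 2 ≤ 1 :=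
    (sum_le_sum_of_subset_of_nonneg (erase_subset _ _) fun S _ _ => sq_nonneg _).trans
      ((sum_walshCoeff_sq f).trans_le hf₂)
  calc ∑ S ∈ s, walshCoeff f S ^ 2 * (1 - η) ^ #S
      ≤ ∑ S ∈ s, walshCoeff f S ^ 2 * ((1 / 16 : ℝ) ^ #S) ^ (η / 3) := by
        gcongr with S
        rw [← Real.rpow_natCast (1 / 16), ← Real.rpow_mul (by norm_num), mul_comm,
          Real.rpow_mul (by norm_num), Real.rpow_natCast]
        exact pow_le_pow_left₀ (by linarith) (one_sub_le_inv_sixteen_rpow hη₀.le) _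
    _ ≤ (∑ S ∈ s, walshCoeff f S ^ 2) ^ (1 - (3 / η)⁻¹) *
          (∑ S ∈ s, walshCoeff f S ^ 2 *
            (((1 / 16 : ℝ) ^ #S) ^ (η / 3)) ^ (3 / η)) ^ (3 / η)⁻¹ := by
        refine Real.inner_le_weight_mul_Lp_of_nonneg s ?_ _ _ (fun S => sq_nonneg _)
          (fun S => by positivity)
        rw [le_div_iff₀ hη₀]
        linarith
    _ = (∑ S ∈ s, walshCoeff f S ^ 2) ^ (1 - η / 3) *
          (∑ S ∈ s, walshCoeff f S ^ 2 * (1 / 16 : ℝ) ^ #S) ^ (η / 3) := by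
        rw [inv_div]
        congr 3 with S
        rw [← Real.rpow_mul (by positivity), div_mul_div_cancel₀ (by norm_num),
          div_self hη₀.ne', Real.rpow_one]
    _ ≤ (∑ S ∈ s, walshCoeff f S ^ 2 * (1 / 16 : ℝ) ^ #S) ^ (η / 3) := by
        refine mul_le_of_le_one_left (by positivity) ?_
        exact Real.rpow_le_one (sum_nonneg fun S _ => sq_nonneg _) hs (by linarith)
    _ ≤ √(∑ i, (cubeE n fun x => |Dop n i f x|) ^ 2) ^ (η / 3) := by
        gcongr
        exact sum_inv_sixteen_pow_mul_walshCoeff_sq_le f hf₂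
    _ = (∑ i, (cubeE n fun x => |Dop n i f x|) ^ 2) ^ (1 / 6 * η) := by
        rw [Real.sqrt_eq_rpow, ← Real.rpow_mul (by positivity)]
        ring_nf
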